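/- arXiv:1602.07180 — 2 statements merged into one kernel-verified Lean document; each statement's English description precedes it below -/
import Mathlib

section
/- Let s > 1 and define S'(n) = #{(a, b) ∈ ℕ × ℕ∗ : a² + b² = n}. Then ∑_{n=1}^∞ S'(n)/nˢ = ζ(s) · β(s), where ζ(s) = ∑_{k≥1} k^{-s} is the Riemann zeta function and β(s) = ∑_{n=0}^∞ (−1)ⁿ/(2n+1)ˢ is the Dirichlet beta function. Equivalently, if X follows the Zeta law of parameter s then E[S'(X)] = β(s). -/
open MeasureTheory

/-- `S' n` is the number of representations `n = a² + b²` with `a ≥ 0` and `b ≥ 1`. -/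
noncomputable def sumTwoSquaresCount (n : ℕ) : ℕ :=
  {p : ℕ × ℕ | p.1 ^ 2 + p.2 ^ 2 = n ∧ 1 ≤ p.2}.ncard

/-- The sum `ζ(s) = ∑_{n ≥ 1} n ^ (-s)` (the `n = 0` term vanishes since `0 ^ (-s) = 0`). -/
noncomputable def zetaSum (s : ℝ) : ℝ := ∑' n : ℕ, (n : ℝ) ^ (-s)

/-- The Dirichlet beta function `β(s) = ∑_{n ≥ 0} (-1)ⁿ / (2n+1)ˢ`. -/
noncomputable def betaSum (s : ℝ) : ℝ := ∑' n : ℕ, (-1) ^ n / (2 * (n : ℝ) + 1) ^ s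

/-- The Zeta law of parameter `s`: the probability measure on the positive integers
assigning mass `n ^ (-s) / ζ(s)` to each `n ≥ 1`. -/
noncomputable def zetaMeasure (s : ℝ) : Measure ℕ :=
  Measure.count.withDensity fun n => ENNReal.ofReal ((n : ℝ) ^ (-s) / zetaSum s)

open ZMod (χ₄)

/-- A function on the positive integers satisfying the Hecke relations of a degree two Euler
product is determined by its value at `1`. -/
theorem eq_of_hecke_relation {χ F G : ℕ → ℤ} (h_one : F 1 = G 1)
    (hF : ∀ p m, p.Prime → m ≠ 0 →
      F (p * m) = (1 + χ p) * F m - χ p * if p ∣ m then F (m / p) else 0)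
    (hG : ∀ p m, p.Prime → m ≠ 0 →
      G (p * m) = (1 + χ p) * G m - χ p * if p ∣ m then G (m / p) else 0)
    {n : ℕ} (hn : n ≠ 0) : F n = G n := by
  induction n using Nat.strong_induction_on with
  | _ n ih =>
    rcases eq_or_ne n 1 with rfl | hn1
    · exact h_one
    obtain ⟨p, hp, m, rfl⟩ := Nat.exists_prime_and_dvd hn1
    have hm : m ≠ 0 := by rintro rfl; simp at hn
    have hlt : m < p * m := by nlinarith [hp.two_le, Nat.pos_of_ne_zero hm]
    rw [hF p m hp hm, hG p m hp hm, ih m hlt hm]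
    split_ifs with hpm
    · rw [ih (m / p) ((Nat.div_le_self m p).trans_lt hlt)
        (Nat.div_pos (Nat.le_of_dvd (Nat.pos_of_ne_zero hm) hpm) hp.pos).ne']
    · rfl

/-- The divisor sum of the quadratic character modulo `4`. -/
def sumDivisorsChi (n : ℕ) : ℤ := ∑ d ∈ n.divisors, χ₄ d

theorem divisors_prime_mul {p : ℕ} (hp : p.Prime) (m : ℕ) :
    (p * m).divisors = m.divisors ∪ m.divisors.image (p * ·) := by
  rw [Nat.divisors_mul, hp.divisors]
  ext d
  simp only [Finset.mem_mul, Finset.mem_union, Finset.mem_image, Finset.mem_insert,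
    Finset.mem_singleton]
  constructor
  · rintro ⟨a, rfl | rfl, b, hb, rfl⟩
    · left; simpa using hb
    · exact Or.inr ⟨b, hb, rfl⟩
  · rintro (h | ⟨b, hb, rfl⟩)
    · exact ⟨1, Or.inl rfl, d, h, one_mul d⟩
    · exact ⟨p, Or.inr rfl, b, hb, rfl⟩

theorem divisors_inter_image_prime_mul {p m : ℕ} (hp : p.Prime) (hm : m ≠ 0) :
    m.divisors ∩ m.divisors.image (p * ·) =
      if p ∣ m then (m / p).divisors.image (p * ·) else ∅ := by
  split_ifs with hpm
  · obtain ⟨k, rfl⟩ := hpm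
    have hk : k ≠ 0 := by rintro rfl; simp at hm
    ext d
    simp only [Finset.mem_inter, Finset.mem_image, Nat.mem_divisors,
      Nat.mul_div_cancel_left k hp.pos]
    constructor
    · rintro ⟨⟨h, -⟩, b, -, rfl⟩
      exact ⟨b, ⟨(Nat.mul_dvd_mul_iff_left hp.pos).1 h, hk⟩, rfl⟩
    · rintro ⟨b, ⟨hb, -⟩, rfl⟩
      exact ⟨⟨Nat.mul_dvd_mul_left p hb, hm⟩, b, ⟨hb.mul_left p, hm⟩, rfl⟩
  · ext d
    simp only [Finset.mem_inter, Finset.mem_image, Nat.mem_divisors, Finset.notMem_empty,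
      iff_false]
    rintro ⟨⟨h, -⟩, b, -, rfl⟩
    exact hpm ((dvd_mul_right p b).trans h)

theorem sumDivisorsChi_prime_mul (p m : ℕ) (hp : p.Prime) (hm : m ≠ 0) :
    sumDivisorsChi (p * m) = (1 + χ₄ p) * sumDivisorsChi m -
      χ₄ p * if p ∣ m then sumDivisorsChi (m / p) else 0 := by
  have hsum (k : ℕ) : ∑ d ∈ k.divisors.image (p * ·), χ₄ d = χ₄ p * sumDivisorsChi k := by
    rw [Finset.sum_image fun a _ b _ h ↦ Nat.eq_of_mul_eq_mul_left hp.pos h, sumDivisorsChi,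
      Finset.mul_sum]
    simp only [Nat.cast_mul, map_mul]
  have key := Finset.sum_union_inter (s₁ := m.divisors) (s₂ := m.divisors.image (p * ·))
    (f := fun d : ℕ ↦ χ₄ d)
  rw [← divisors_prime_mul hp m, divisors_inter_image_prime_mul hp hm, hsum] at key
  change sumDivisorsChi (p * m) + _ = sumDivisorsChi m + _ at key
  split_ifs at key ⊢
  · rw [hsum] at key
    linarith
  · simp only [Finset.sum_empty] at key
    linarith

namespace GaussianInt

/-- The set of Gaussian integers of norm `n`. -/
def normFiber (n : ℕ) : Set GaussianInt := {z | z.norm = n}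

theorem norm_eq_sq_add_sq (z : GaussianInt) : z.norm = z.re ^ 2 + z.im ^ 2 := by
  rw [Zsqrtd.norm_def]; ring

theorem finite_normFiber (n : ℕ) : (normFiber n).Finite := by
  refine (((Set.finite_Icc (-n : ℤ) n).prod (Set.finite_Icc (-n : ℤ) n)).image
    fun q ↦ (⟨q.1, q.2⟩ : GaussianInt)).subset fun z hz ↦ ?_
  have h : z.re ^ 2 + z.im ^ 2 = n := (norm_eq_sq_add_sq z).symm.trans hz
  refine ⟨(z.re, z.im), ⟨⟨?_, ?_⟩, ?_, ?_⟩, rfl⟩ <;> dsimp only <;>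
    nlinarith [sq_nonneg z.re, sq_nonneg z.im]

theorem ncard_normFiber {n : ℕ} (hn : n ≠ 0) :
    (normFiber n).ncard = 4 * sumTwoSquaresCount n := by
  set Q : Set GaussianInt := {z ∈ normFiber n | 0 ≤ z.re ∧ 1 ≤ z.im} with hQ
  set A : Set GaussianInt := Q ∪ (fun z ↦ (⟨-z.im, z.re⟩ : GaussianInt)) '' Q with hA
  have mem_A (z : GaussianInt) :
      z ∈ A ↔ z ∈ normFiber n ∧ (0 ≤ z.re ∧ 1 ≤ z.im ∨ z.re ≤ -1 ∧ 0 ≤ z.im) := by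
    simp only [hA, hQ, normFiber, norm_eq_sq_add_sq, Set.mem_union, Set.mem_image,
      Set.mem_ofPred_eq]
    constructor
    · rintro (⟨h, h'⟩ | ⟨w, ⟨h, h'⟩, rfl⟩)
      · exact ⟨h, Or.inl h'⟩
      · exact ⟨by dsimp only; linarith, Or.inr (by dsimp only; omega)⟩
    · rintro ⟨h, h' | h'⟩
      · exact Or.inl ⟨h, h'⟩
      · exact Or.inr ⟨⟨z.im, -z.re⟩, ⟨by dsimp only; linarith, by dsimp only; omega⟩, by simp⟩
  have fin_Q : Q.Finite := (finite_normFiber n).subset fun z hz ↦ hz.1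
  have fin_A : A.Finite := fin_Q.union (fin_Q.image _)
  have card_A : A.ncard = 2 * Q.ncard := by
    rw [hA, Set.ncard_union_eq _ fin_Q (fin_Q.image _), Set.ncard_image_of_injective, two_mul]
    · intro z w h
      simp only [Zsqrtd.mk.injEq, neg_inj] at h
      exact Zsqrtd.ext h.2 h.1
    · rw [Set.disjoint_left]
      rintro _ ⟨-, h, -⟩ ⟨w, ⟨-, -, h'⟩, rfl⟩
      dsimp only at h
      omega
  have hN : normFiber n = A ∪ (fun z ↦ -z) '' A := by
    ext z
    simp only [Set.mem_union, Set.mem_image, mem_A]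
    constructor
    · intro hz
      have h0 : z.re ≠ 0 ∨ z.im ≠ 0 := by
        by_contra! h
        have : z.re ^ 2 + z.im ^ 2 = n := (norm_eq_sq_add_sq z).symm.trans hz
        simp [h] at this
        omega
      by_cases h : 0 ≤ z.re ∧ 1 ≤ z.im ∨ z.re ≤ -1 ∧ 0 ≤ z.im
      · exact Or.inl ⟨hz, h⟩
      · refine Or.inr ⟨-z, ⟨(Zsqrtd.norm_neg z).trans hz, ?_⟩, neg_neg z⟩
        rw [Zsqrtd.re_neg, Zsqrtd.im_neg]
        omega
    · rintro (h | ⟨w, ⟨h, -⟩, rfl⟩)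
      · exact h.1
      · exact (Zsqrtd.norm_neg w).trans h
  have card_Q : Q.ncard = sumTwoSquaresCount n := by
    have : Q = (fun q : ℕ × ℕ ↦ (⟨q.1, q.2⟩ : GaussianInt)) ''
        {p : ℕ × ℕ | p.1 ^ 2 + p.2 ^ 2 = n ∧ 1 ≤ p.2} := by
      ext z
      simp only [hQ, normFiber, norm_eq_sq_add_sq, Set.mem_image, Set.mem_ofPred_eq]
      constructor
      · rintro ⟨h, h₁, h₂⟩
        refine ⟨(z.re.toNat, z.im.toNat), ⟨?_, by dsimp only; omega⟩, ?_⟩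
        · zify
          simpa [Int.toNat_of_nonneg h₁, max_eq_left h₁, max_eq_left (zero_le_one.trans h₂)] using h
        · ext <;> dsimp only <;> omega
      · rintro ⟨q, ⟨h, h'⟩, rfl⟩
        exact ⟨by dsimp only; exact_mod_cast h, by dsimp only; omega, by dsimp only; omega⟩
    rw [this, Set.ncard_image_of_injective, sumTwoSquaresCount]
    intro q r h
    simpa [Prod.ext_iff] using h
  rw [hN, Set.ncard_union_eq _ fin_A (fin_A.image _),
    Set.ncard_image_of_injective _ neg_injective, card_A, card_Q]
  · ring
  · rw [Set.disjoint_left]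
    rintro _ h ⟨w, h', rfl⟩
    rw [mem_A] at h h'
    have h₁ := h.2
    rw [Zsqrtd.re_neg, Zsqrtd.im_neg] at h₁
    omega

theorem prime_of_norm_prime {π : GaussianInt} {p : ℕ} (hp : p.Prime) (hπ : π.norm = p) :
    Prime π := by
  rw [← irreducible_iff_prime]
  refine ⟨fun h ↦ ?_, fun a b hab ↦ ?_⟩
  · rw [← Zsqrtd.norm_eq_one_iff, hπ] at h
    exact hp.one_lt.ne' (by simpa using h)
  · have : a.norm.natAbs * b.norm.natAbs = p := by
      rw [← Int.natAbs_mul, ← Zsqrtd.norm_mul, ← hab, hπ, Int.natAbs_natCast]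
    rw [← Zsqrtd.norm_eq_one_iff, ← Zsqrtd.norm_eq_one_iff]
    rcases Nat.prime_mul_iff.1 (this ▸ hp) with h | h <;> tauto

theorem star_dvd_star {a b : GaussianInt} (h : a ∣ b) : star a ∣ star b := by
  obtain ⟨c, rfl⟩ := h
  exact ⟨star c, by rw [star_mul, mul_comm]⟩

theorem dvd_or_star_dvd {π z : GaussianInt} (hπ : Prime π) (h : π ∣ (z.norm : GaussianInt)) :
    π ∣ z ∨ star π ∣ z := by
  rw [Zsqrtd.norm_eq_mul_conj] at h
  exact (hπ.dvd_or_dvd h).imp_right fun h ↦ by simpa using star_dvd_star h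

/-- Gaussian integers of norm `N(a) m` divisible by `a` correspond to those of norm `m`. -/
theorem image_mul_normFiber {a : GaussianInt} {k : ℕ} (ha : a.norm = k) (hk : k ≠ 0) (m : ℕ) :
    (a * ·) '' normFiber m = {z ∈ normFiber (k * m) | a ∣ z} := by
  ext z
  simp only [normFiber, Set.mem_image, Set.mem_ofPred_eq]
  constructor
  · rintro ⟨w, hw, rfl⟩
    exact ⟨by rw [Zsqrtd.norm_mul, ha, hw, Nat.cast_mul], dvd_mul_right a w⟩
  · rintro ⟨hz, w, rfl⟩
    rw [Zsqrtd.norm_mul, ha, Nat.cast_mul] at hz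
    exact ⟨w, mul_left_cancel₀ (Nat.cast_ne_zero.2 hk) hz, rfl⟩

theorem ncard_dvd_normFiber {a : GaussianInt} {k : ℕ} (ha : a.norm = k) (hk : k ≠ 0) (m : ℕ) :
    {z ∈ normFiber (k * m) | a ∣ z}.ncard = (normFiber m).ncard := by
  have ha0 : a ≠ 0 := by
    rintro rfl
    exact hk (by simpa using ha.symm)
  rw [← image_mul_normFiber ha hk, Set.ncard_image_of_injective _ (mul_right_injective₀ ha0)]

theorem ncard_natCast_dvd_normFiber {p m : ℕ} (hp : p.Prime) :
    {z ∈ normFiber (p * m) | (p : GaussianInt) ∣ z}.ncard =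
      if p ∣ m then (normFiber (m / p)).ncard else 0 := by
  split_ifs with hpm
  · obtain ⟨k, rfl⟩ := hpm
    rw [← mul_assoc, Nat.mul_div_cancel_left k hp.pos]
    exact ncard_dvd_normFiber (by rw [Zsqrtd.norm_natCast, Nat.cast_mul])
      (mul_ne_zero hp.ne_zero hp.ne_zero) k
  · rw [Set.ncard_eq_zero ((finite_normFiber _).subset fun z hz ↦ hz.1),
      Set.eq_empty_iff_forall_notMem]
    rintro _ ⟨hz, w, rfl⟩
    have h : ((p * p : ℕ) : ℤ) * w.norm = p * m := by
      simpa [normFiber, Zsqrtd.norm_mul, Zsqrtd.norm_natCast] using hz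
    rw [Nat.cast_mul, mul_assoc] at h
    have h' := mul_left_cancel₀ (Nat.cast_ne_zero.2 hp.ne_zero) h
    exact hpm (Int.natCast_dvd_natCast.1 ⟨w.norm, h'.symm⟩)

theorem natCast_dvd_norm {p m : ℕ} {z : GaussianInt} (hz : z ∈ normFiber (p * m)) :
    (p : GaussianInt) ∣ (z.norm : GaussianInt) := by
  rw [show z.norm = ((p * m : ℕ) : ℤ) from hz]
  exact ⟨m, by push_cast; rfl⟩

theorem ncard_normFiber_two_mul (m : ℕ) :
    (normFiber (2 * m)).ncard = (normFiber m).ncard := by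
  have hπ : (⟨1, 1⟩ : GaussianInt).norm = (2 : ℕ) := by simp [norm_eq_sq_add_sq]
  rw [← ncard_dvd_normFiber hπ two_ne_zero m]
  congr 1
  ext z
  refine ⟨fun hz ↦ ⟨hz, ?_⟩, fun hz ↦ hz.1⟩
  have h : z.re ^ 2 + z.im ^ 2 = 2 * m := by
    rw [← norm_eq_sq_add_sq, show z.norm = ((2 * m : ℕ) : ℤ) from hz]
    push_cast; rfl
  have hpar : Even (z.re + z.im) := by
    have : Even (z.re ^ 2 + z.im ^ 2) := ⟨m, by rw [h]; ring⟩
    simpa [Int.even_add, Int.even_pow] using this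
  obtain ⟨t, ht⟩ := hpar
  refine ⟨⟨t, t - z.re⟩, ?_⟩
  ext
  · simp
  · simp
    linarith

theorem ncard_normFiber_mul_of_mod_four_eq_three {p : ℕ} (hp : p.Prime) (h3 : p % 4 = 3) (m : ℕ) :
    (normFiber (p * m)).ncard = if p ∣ m then (normFiber (m / p)).ncard else 0 := by
  have := Fact.mk hp
  have hP := prime_of_nat_prime_of_mod_four_eq_three p h3
  rw [← ncard_natCast_dvd_normFiber hp]
  congr 1
  ext z
  refine ⟨fun hz ↦ ⟨hz, ?_⟩, fun hz ↦ hz.1⟩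
  simpa using dvd_or_star_dvd hP (natCast_dvd_norm hz)

theorem isCoprime_star_of_norm_eq {p : ℕ} (hp : p.Prime) (h2 : p ≠ 2) {π : GaussianInt}
    (hπ : π.norm = p) : IsCoprime π (star π) := by
  have hsq : π.re ^ 2 + π.im ^ 2 = p := (norm_eq_sq_add_sq π).symm.trans hπ
  have hpZ : Prime (p : ℤ) := Nat.prime_iff_prime_int.1 hp
  have hcop : IsCoprime (p : ℤ) (2 * π.re) := by
    rw [hpZ.coprime_iff_not_dvd]
    intro h
    rcases hpZ.dvd_or_dvd h with h | h
    · exact h2 ((Nat.prime_dvd_prime_iff_eq hp Nat.prime_two).1 (by exact_mod_cast h))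
    · have him : (p : ℤ) ∣ π.im := by
        refine hpZ.dvd_of_dvd_pow (n := 2) ?_
        rw [← (Int.dvd_add_right (h.pow two_ne_zero)), hsq]
      have : (p : ℤ) ^ 2 ∣ p := by
        rw [← hsq]
        nth_rw 1 [hsq]
        exact dvd_add (pow_dvd_pow_of_dvd h 2) (pow_dvd_pow_of_dvd him 2)
      have h1 : (p : ℤ) * p ∣ p * 1 := by simpa [sq] using this
      exact hpZ.not_isUnit (isUnit_of_dvd_one ((mul_dvd_mul_iff_left hpZ.ne_zero).1 h1))
  obtain ⟨u, v, huv⟩ := hcop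
  have htr : ((2 * π.re : ℤ) : GaussianInt) = π + star π := by
    ext <;> simp [two_mul]
  have hnm : ((p : ℤ) : GaussianInt) = π * star π := by rw [← hπ, Zsqrtd.norm_eq_mul_conj]
  have h : (u : GaussianInt) * (π * star π) + v * (π + star π) = 1 := by
    rw [← htr, ← hnm]
    exact_mod_cast congrArg (Int.cast : ℤ → GaussianInt) huv
  exact ⟨u * star π + v, v, by rw [← h]; ring⟩

theorem ncard_normFiber_mul_of_mod_four_eq_one {p : ℕ} (hp : p.Prime) (h1 : p % 4 = 1) (m : ℕ) :
    (normFiber (p * m)).ncard + (if p ∣ m then (normFiber (m / p)).ncard else 0) =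
      2 * (normFiber m).ncard := by
  have := Fact.mk hp
  obtain ⟨a, b, hab⟩ := Nat.Prime.sq_add_sq (p := p) (by omega)
  set π : GaussianInt := ⟨a, b⟩
  have hπ : π.norm = p := by
    rw [norm_eq_sq_add_sq, ← hab]
    push_cast
    rfl
  have hπ' : (star π).norm = p := by rw [Zsqrtd.norm_conj, hπ]
  have hnm : (p : GaussianInt) = π * star π := by
    rw [← Zsqrtd.norm_eq_mul_conj, hπ, Int.cast_natCast]
  have hfin (c : GaussianInt) : {z ∈ normFiber (p * m) | c ∣ z}.Finite :=
    (finite_normFiber _).subset fun z hz ↦ hz.1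
  have key := Set.ncard_union_add_ncard_inter _ _ (hfin π) (hfin (star π))
  have hunion : {z ∈ normFiber (p * m) | π ∣ z} ∪ {z ∈ normFiber (p * m) | star π ∣ z} =
      normFiber (p * m) := by
    ext z
    refine ⟨fun hz ↦ hz.elim And.left And.left, fun hz ↦ ?_⟩
    have hdvd : π ∣ (z.norm : GaussianInt) :=
      (Dvd.intro _ hnm.symm).trans (natCast_dvd_norm hz)
    exact (dvd_or_star_dvd (prime_of_norm_prime hp hπ) hdvd).imp (⟨hz, ·⟩) (⟨hz, ·⟩)
  have hinter : {z ∈ normFiber (p * m) | π ∣ z} ∩ {z ∈ normFiber (p * m) | star π ∣ z} =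
      {z ∈ normFiber (p * m) | (p : GaussianInt) ∣ z} := by
    ext z
    refine ⟨fun hz ↦ ⟨hz.1.1, ?_⟩, fun hz ↦ ⟨⟨hz.1, ?_⟩, hz.1, ?_⟩⟩
    · rw [hnm]
      exact (isCoprime_star_of_norm_eq hp (by omega) hπ).mul_dvd hz.1.2 hz.2.2
    · exact (Dvd.intro _ hnm.symm).trans hz.2
    · exact (Dvd.intro_left _ hnm.symm).trans hz.2
  rw [hunion, hinter, ncard_dvd_normFiber hπ hp.ne_zero, ncard_dvd_normFiber hπ' hp.ne_zero,
    ncard_natCast_dvd_normFiber hp] at key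
  rw [key, two_mul]

theorem ncard_normFiber_prime_mul (p m : ℕ) (hp : p.Prime) :
    ((normFiber (p * m)).ncard : ℤ) = (1 + χ₄ p) * (normFiber m).ncard -
      χ₄ p * if p ∣ m then ((normFiber (m / p)).ncard : ℤ) else 0 := by
  rcases hp.eq_two_or_odd with rfl | hodd
  · have : χ₄ ((2 : ℕ) : ZMod 4) = 0 := by decide
    rw [this, ncard_normFiber_two_mul]
    ring
  rcases Nat.odd_mod_four_iff.1 hodd with h | h
  · have key := ncard_normFiber_mul_of_mod_four_eq_one hp h m
    rw [ZMod.χ₄_nat_one_mod_four h]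
    split_ifs at key ⊢ <;> omega
  · have key := ncard_normFiber_mul_of_mod_four_eq_three hp h m
    rw [ZMod.χ₄_nat_three_mod_four h]
    split_ifs at key ⊢ <;> omega

end GaussianInt

theorem sumTwoSquaresCount_zero : sumTwoSquaresCount 0 = 0 := by
  have : {p : ℕ × ℕ | p.1 ^ 2 + p.2 ^ 2 = 0 ∧ 1 ≤ p.2} = ∅ := by
    ext p
    simp only [Set.mem_ofPred_eq, Set.mem_empty_iff_false, iff_false]
    rintro ⟨h, hp⟩
    nlinarith
  rw [sumTwoSquaresCount, this, Set.ncard_empty]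

theorem sumTwoSquaresCount_one : sumTwoSquaresCount 1 = 1 := by
  rw [sumTwoSquaresCount, Set.ncard_eq_one]
  refine ⟨(0, 1), ?_⟩
  ext ⟨a, b⟩
  simp only [Set.mem_ofPred_eq, Set.mem_singleton_iff, Prod.mk.injEq]
  refine ⟨fun ⟨h, hb⟩ ↦ ⟨?_, ?_⟩, ?_⟩
  · nlinarith
  · nlinarith
  · rintro ⟨rfl, rfl⟩
    norm_num

/-- **Jacobi's two-square theorem**. -/
theorem sumTwoSquaresCount_eq_sumDivisorsChi {n : ℕ} (hn : n ≠ 0) :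
    (sumTwoSquaresCount n : ℤ) = sumDivisorsChi n := by
  have key : ((GaussianInt.normFiber n).ncard : ℤ) = 4 * sumDivisorsChi n := by
    refine eq_of_hecke_relation (χ := fun p ↦ χ₄ p)
      (F := fun n ↦ ((GaussianInt.normFiber n).ncard : ℤ)) (G := fun n ↦ 4 * sumDivisorsChi n)
      ?_ (fun p m hp _ ↦ GaussianInt.ncard_normFiber_prime_mul p m hp) (fun p m hp hm ↦ ?_) hn
    · simp [GaussianInt.ncard_normFiber one_ne_zero, sumTwoSquaresCount_one, sumDivisorsChi]
    · rw [sumDivisorsChi_prime_mul p m hp hm]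
      split_ifs <;> ring
  rw [GaussianInt.ncard_normFiber hn] at key
  push_cast at key
  linarith

theorem LSeriesHasSum_ofReal_iff {f : ℕ → ℝ} (hf : f 0 = 0) {s a : ℝ} :
    LSeriesHasSum (fun n ↦ (f n : ℂ)) s a ↔ HasSum (fun n : ℕ ↦ f n * (n : ℝ) ^ (-s)) a := by
  rw [LSeriesHasSum, ← Complex.hasSum_ofReal]
  refine iff_of_eq (congrArg (HasSum · (a : ℂ)) (funext fun n ↦ ?_))
  rw [LSeries.term_def₀ (by simp [hf])]
  push_cast [Complex.ofReal_cpow (Nat.cast_nonneg n)]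
  rfl

theorem hasSum_zetaSum {s : ℝ} (hs : 1 < s) :
    HasSum (fun n : ℕ ↦ (n : ℝ) ^ (-s)) (zetaSum s) :=
  (Real.summable_nat_rpow.2 (by linarith)).hasSum

theorem hasSum_betaSum {s : ℝ} (hs : 1 < s) :
    HasSum (fun n : ℕ ↦ (χ₄ n : ℝ) * (n : ℝ) ^ (-s)) (betaSum s) := by
  have hinj : Function.Injective fun k : ℕ ↦ 2 * k + 1 := fun a b h ↦ by
    dsimp only at h
    omega
  have hsum : Summable fun n : ℕ ↦ (χ₄ n : ℝ) * (n : ℝ) ^ (-s) := by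
    refine (hasSum_zetaSum hs).summable.of_norm_bounded fun n ↦ ?_
    rw [norm_mul, Real.norm_of_nonneg (Real.rpow_nonneg (Nat.cast_nonneg n) _)]
    refine mul_le_of_le_one_left (Real.rpow_nonneg (Nat.cast_nonneg n) _) ?_
    rcases ZMod.isQuadratic_χ₄ n with h | h | h <;> simp [h]
  have hzero : ∀ n ∉ Set.range fun k : ℕ ↦ 2 * k + 1, (χ₄ n : ℝ) * (n : ℝ) ^ (-s) = 0 := by
    intro n hn
    have hn2 : n % 2 = 0 := by
      by_contra h
      exact hn ⟨n / 2, by dsimp only; omega⟩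
    rw [ZMod.χ₄_nat_eq_if_mod_four, if_pos hn2, Int.cast_zero, zero_mul]
  have hterm : (fun n : ℕ ↦ (χ₄ n : ℝ) * (n : ℝ) ^ (-s)) ∘ (fun k : ℕ ↦ 2 * k + 1) =
      fun n : ℕ ↦ (-1) ^ n / (2 * (n : ℝ) + 1) ^ s := by
    funext k
    rw [Function.comp_apply, ZMod.χ₄_eq_neg_one_pow (by omega),
      show (2 * k + 1) / 2 = k by omega, Real.rpow_neg (Nat.cast_nonneg _), div_eq_mul_inv]
    push_cast
    rfl
  rw [← hinj.hasSum_iff hzero, hterm]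
  have := (hinj.summable_iff hzero).2 hsum
  rw [hterm] at this
  exact this.hasSum

theorem hasSum_sumTwoSquaresCount {s : ℝ} (hs : 1 < s) :
    HasSum (fun n : ℕ ↦ (sumTwoSquaresCount n : ℝ) * (n : ℝ) ^ (-s)) (zetaSum s * betaSum s) := by
  have hζ : LSeriesHasSum (fun n ↦ ((if n = 0 then 0 else 1 : ℝ) : ℂ)) s (zetaSum s) := by
    rw [LSeriesHasSum_ofReal_iff (f := fun n ↦ if n = 0 then 0 else 1) (by simp)]
    refine (hasSum_zetaSum hs).congr_fun fun n ↦ ?_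
    split_ifs with hn
    · rw [hn, Nat.cast_zero, Real.zero_rpow (by linarith), zero_mul]
    · rw [one_mul]
  have hβ : LSeriesHasSum (fun n ↦ (((χ₄ n : ℤ) : ℝ) : ℂ)) s (betaSum s) :=
    (LSeriesHasSum_ofReal_iff (f := fun n ↦ ((χ₄ n : ℤ) : ℝ)) (by simp)).2 (hasSum_betaSum hs)
  have hmul := hζ.convolution hβ
  rw [← Complex.ofReal_mul] at hmul
  refine (LSeriesHasSum_ofReal_iff (f := fun n ↦ (sumTwoSquaresCount n : ℝ)) ?_).1
    ((LSeriesHasSum_congr s _ fun {n} hn ↦ ?_).1 hmul)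
  · simp [sumTwoSquaresCount_zero]
  · rw [LSeries.convolution_def, ← Int.cast_natCast (sumTwoSquaresCount n),
      sumTwoSquaresCount_eq_sumDivisorsChi hn, sumDivisorsChi,
      ← Nat.sum_divisorsAntidiagonal' (fun _ d ↦ χ₄ d)]
    push_cast
    refine Finset.sum_congr rfl fun q hq ↦ ?_
    rw [if_neg (Nat.ne_zero_of_mem_divisorsAntidiagonal hq).1]
    simp

/-- For `s > 1`, `∑_{n ≥ 1} S'(n) / nˢ = ζ(s) β(s)`; equivalently, if `X` follows the
Zeta law of parameter `s`, then `E[S'(X)] = β(s)`. -/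
theorem sum_sumTwoSquaresCount_eq_zeta_mul_beta (s : ℝ) (hs : 1 < s) :
    (∑' n : ℕ, (sumTwoSquaresCount n : ℝ) * (n : ℝ) ^ (-s)) = zetaSum s * betaSum s ∧
    ∫ x, (sumTwoSquaresCount x : ℝ) ∂(zetaMeasure s) = betaSum s := by
  have hsum := hasSum_sumTwoSquaresCount hs
  have hpos : 0 < zetaSum s :=
    (hasSum_zetaSum hs).summable.tsum_pos (fun n ↦ by positivity) 1 (by simp)
  refine ⟨hsum.tsum_eq, ?_⟩
  have hterm (n : ℕ) : (ENNReal.ofReal ((n : ℝ) ^ (-s) / zetaSum s)).toReal •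
      (sumTwoSquaresCount n : ℝ) =
        (sumTwoSquaresCount n : ℝ) * (n : ℝ) ^ (-s) / zetaSum s := by
    rw [ENNReal.toReal_ofReal (by positivity), smul_eq_mul]
    ring
  have hsum' := hsum.div_const (zetaSum s)
  rw [mul_div_cancel_left₀ _ hpos.ne'] at hsum'
  rw [zetaMeasure, integral_withDensity_eq_integral_toReal_smul (by fun_prop) (by simp)]
  simp_rw [hterm]
  rw [integral_countable (integrable_count_iff.2 hsum'.summable.norm)]
  simpa [Measure.real] using hsum'.tsum_eq
end

section
/- In the ring ℤ[i] of Gaussian integers, the asymptotic density of coprime pairs equals 1/(ζ(2)β(2)): letting Bₙ = {z ∈ ℤ[i] : z ≠ 0, N(z) ≤ n²} where N(a+bi) = a² + b², one has #{(z, w) ∈ Bₙ × Bₙ : z and w are coprime in ℤ[i]} / (#Bₙ)² → 1/(ζ(2)β(2)) as n → ∞, where ζ(2) = π²/6 and β(2) = ∑_{n=0}^∞ (−1)ⁿ/(2n+1)² is Catalan's constant. -/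
open Filter Topology Real

/-- Iterating a Dirichlet convolution acting on functions of `⌊N / n⌋`. -/
theorem ArithmeticFunction.sum_Ioc_mul_apply_div {R : Type*} [CommSemiring R]
    (f g : ArithmeticFunction R) (F : ℕ → R) (N : ℕ) :
    ∑ n ∈ Finset.Ioc 0 N, (f * g) n * F (N / n) =
      ∑ n ∈ Finset.Ioc 0 N, f n * ∑ m ∈ Finset.Ioc 0 (N / n), g m * F (N / n / m) := by
  simp_rw [ArithmeticFunction.mul_apply, Finset.sum_mul, Finset.mul_sum, Finset.sum_sigma']
  refine Finset.sum_bij' (fun x _ ↦ ⟨x.2.1, x.2.2⟩) (fun y _ ↦ ⟨y.1 * y.2, (y.1, y.2)⟩)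
    ?_ ?_ ?_ ?_ ?_
  · rintro ⟨k, n, m⟩ h
    simp only [Finset.mem_sigma, Finset.mem_Ioc, Nat.mem_divisorsAntidiagonal] at h ⊢
    obtain ⟨⟨hk, hkN⟩, rfl, -⟩ := h
    have hn := Nat.pos_of_mul_pos_right hk
    have hm := Nat.pos_of_mul_pos_left hk
    exact ⟨⟨hn, (Nat.le_mul_of_pos_right n hm).trans hkN⟩, hm,
      (Nat.le_div_iff_mul_le hn).2 (by rwa [mul_comm])⟩
  · rintro ⟨n, m⟩ h
    simp only [Finset.mem_sigma, Finset.mem_Ioc, Nat.mem_divisorsAntidiagonal] at h ⊢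
    have hm := (Nat.le_div_iff_mul_le h.1.1).1 h.2.2
    have := Nat.mul_pos h.1.1 h.2.1
    exact ⟨⟨this, by rwa [mul_comm]⟩, trivial, this.ne'⟩
  · rintro ⟨k, n, m⟩ h
    simp only [Finset.mem_sigma, Nat.mem_divisorsAntidiagonal] at h
    obtain ⟨-, rfl, -⟩ := h
    rfl
  · rintro ⟨n, m⟩ -
    rfl
  · rintro ⟨k, n, m⟩ h
    simp only [Finset.mem_sigma, Nat.mem_divisorsAntidiagonal] at h
    obtain ⟨-, rfl, -⟩ := h
    simp only [Nat.div_div_eq_div_mul, mul_assoc]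

namespace GaussianInt

/-- The norm of an associate class of Gaussian integers, as a natural number. -/
def associatesNorm : Associates GaussianInt →* ℕ where
  toFun := Quotient.lift (fun z : GaussianInt ↦ z.norm.natAbs) fun a b h ↦ by
    obtain ⟨u, rfl⟩ := h
    have := Zsqrtd.norm_eq_one_iff.2 u.isUnit
    simp [Zsqrtd.norm_mul, Int.natAbs_mul, this]
  map_one' := by simp [← Associates.mk_one, Associates.mk, Quotient.lift_mk]
  map_mul' := by
    rintro ⟨a⟩ ⟨b⟩
    exact (congrArg Int.natAbs (Zsqrtd.norm_mul a b)).trans (Int.natAbs_mul _ _)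

@[simp]
theorem associatesNorm_mk (z : GaussianInt) :
    associatesNorm (Associates.mk z) = z.norm.natAbs := rfl

theorem associatesNorm_eq_one_iff {c : Associates GaussianInt} :
    associatesNorm c = 1 ↔ c = 1 := by
  obtain ⟨z, rfl⟩ := Associates.mk_surjective c
  rw [associatesNorm_mk, Zsqrtd.norm_eq_one_iff, Associates.mk_eq_one]

theorem associatesNorm_eq_zero_iff {c : Associates GaussianInt} :
    associatesNorm c = 0 ↔ c = 0 := by
  obtain ⟨z, rfl⟩ := Associates.mk_surjective c
  rw [associatesNorm_mk, Int.natAbs_eq_zero, GaussianInt.norm_eq_zero, Associates.mk_eq_zero]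

theorem dvd_norm_natAbs (z : GaussianInt) : z ∣ (z.norm.natAbs : GaussianInt) := by
  rw [natCast_natAbs_norm, Zsqrtd.norm_eq_mul_conj]
  exact dvd_mul_right _ _

theorem isRelPrime_of_coprime_associatesNorm {a b : Associates GaussianInt}
    (h : (associatesNorm a).Coprime (associatesNorm b)) : IsRelPrime a b := by
  intro d hda hdb
  rw [Associates.isUnit_iff_eq_one, ← associatesNorm_eq_one_iff]
  exact Nat.eq_one_of_dvd_coprimes h (map_dvd associatesNorm hda) (map_dvd associatesNorm hdb)

theorem finite_norm_le (T : ℕ) : {z : GaussianInt | z.norm.natAbs ≤ T}.Finite := by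
  refine Set.Finite.of_finite_image (f := fun z ↦ (z.re, z.im))
    (((Set.finite_Icc (-(T : ℤ)) T).prod (Set.finite_Icc (-(T : ℤ)) T)).subset ?_) ?_
  · rintro _ ⟨z, hz, rfl⟩
    have h1 : z.re * z.re + z.im * z.im ≤ T := by
      have : z.norm ≤ T := by
        rw [← abs_natCast_norm]; exact_mod_cast hz
      simpa [Zsqrtd.norm_def] using this
    simp only [Set.mem_prod, Set.mem_Icc]
    refine ⟨⟨?_, ?_⟩, ?_, ?_⟩ <;>
      nlinarith [mul_self_nonneg z.re, mul_self_nonneg z.im, Int.le_self_sq z.re,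
        Int.le_self_sq z.im, Int.le_self_sq (-z.re), Int.le_self_sq (-z.im)]
  · intro z _ w _ h
    simpa [Zsqrtd.ext_iff] using h

theorem finite_associatesNorm_le (T : ℕ) :
    {c : Associates GaussianInt | associatesNorm c ≤ T}.Finite := by
  refine ((finite_norm_le T).image Associates.mk).subset fun c hc ↦ ?_
  obtain ⟨z, rfl⟩ := Associates.mk_surjective c
  exact ⟨z, hc, rfl⟩

/-- The number of classes of associate Gaussian integers of norm `n`, with value `0` at `0`. -/
noncomputable def associatesCount : ArithmeticFunction ℕ where
  toFun n := if n = 0 then 0 else Nat.card {c : Associates GaussianInt // associatesNorm c = n}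
  map_zero' := if_pos rfl

theorem associatesCount_apply {n : ℕ} (hn : n ≠ 0) :
    associatesCount n = Nat.card {c : Associates GaussianInt // associatesNorm c = n} :=
  if_neg hn

theorem associatesCount_isMultiplicative : associatesCount.IsMultiplicative := by
  refine ArithmeticFunction.IsMultiplicative.iff_ne_zero.2 ⟨?_, fun {m n} hm hn hmn ↦ ?_⟩
  · rw [associatesCount_apply one_ne_zero]
    simp [associatesNorm_eq_one_iff]
  rw [associatesCount_apply hm, associatesCount_apply hn, associatesCount_apply (mul_ne_zero hm hn),
    ← Nat.card_prod]
  refine (Nat.card_congr (Equiv.ofBijective (fun x ↦ ⟨x.1.1 * x.2.1, by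
    rw [map_mul, x.1.2, x.2.2]⟩) ⟨?_, ?_⟩)).symm
  · have key (a a' b b' : Associates GaussianInt) (ha : associatesNorm a = m)
        (hb' : associatesNorm b' = n) (h : a * b = a' * b') : a ∣ a' :=
      (isRelPrime_of_coprime_associatesNorm (by rwa [ha, hb'])).dvd_of_dvd_mul_right
        (h ▸ dvd_mul_right a b)
    rintro ⟨⟨a, ha⟩, ⟨b, hb⟩⟩ ⟨⟨a', ha'⟩, ⟨b', hb'⟩⟩ h
    have h : a * b = a' * b' := congrArg Subtype.val h
    obtain rfl : a = a' := dvd_antisymm (key _ _ _ _ ha hb' h) (key _ _ _ _ ha' hb h.symm)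
    have ha0 : a ≠ 0 := by
      rw [Ne, ← associatesNorm_eq_zero_iff, ha]; exact hm
    obtain rfl := mul_left_cancel₀ ha0 h
    rfl
  · rintro ⟨c, hc⟩
    have hdvd : c ∣ Associates.mk (m : GaussianInt) * Associates.mk (n : GaussianInt) := by
      obtain ⟨z, rfl⟩ := Associates.mk_surjective c
      rw [associatesNorm_mk] at hc
      rw [Associates.mk_mul_mk, Associates.mk_dvd_mk, ← Nat.cast_mul, ← hc]
      exact dvd_norm_natAbs z
    obtain ⟨a, b, ha, hb, rfl⟩ := exists_dvd_and_dvd_of_dvd_mul hdvd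
    have ha := map_dvd associatesNorm ha
    have hb := map_dvd associatesNorm hb
    simp only [associatesNorm_mk, Zsqrtd.norm_natCast, Int.natAbs_mul, Int.natAbs_natCast] at ha hb
    rw [map_mul] at hc
    have han : (associatesNorm a).Coprime n := .coprime_dvd_left ha (hmn.mul_left hmn)
    have hbm : m.Coprime (associatesNorm b) := .coprime_dvd_right hb (hmn.mul_right hmn)
    refine ⟨⟨⟨a, ?_⟩, ⟨b, ?_⟩⟩, rfl⟩
    · exact dvd_antisymm (han.dvd_of_dvd_mul_right (hc ▸ dvd_mul_right _ _))
        (hbm.dvd_of_dvd_mul_right (hc ▸ dvd_mul_right _ _))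
    · exact dvd_antisymm (hbm.symm.dvd_of_dvd_mul_left (hc ▸ dvd_mul_left _ _))
        (han.symm.dvd_of_dvd_mul_left (hc ▸ dvd_mul_left _ _))

theorem associatesNorm_mk_natCast (n : ℕ) :
    associatesNorm (Associates.mk (n : GaussianInt)) = n ^ 2 := by
  simp [Zsqrtd.norm_natCast, Int.natAbs_mul, sq]

theorem dvd_mk_natCast_associatesNorm (c : Associates GaussianInt) :
    c ∣ Associates.mk (associatesNorm c : GaussianInt) := by
  obtain ⟨z, rfl⟩ := Associates.mk_surjective c
  exact Associates.mk_dvd_mk.2 (dvd_norm_natAbs z)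

theorem dvd_mk_natCast_pow {c : Associates GaussianInt} {p k : ℕ}
    (hc : associatesNorm c = p ^ k) : c ∣ Associates.mk (p : GaussianInt) ^ k := by
  have := dvd_mk_natCast_associatesNorm c
  rwa [hc, Nat.cast_pow, Associates.mk_pow] at this

theorem prime_of_prime_associatesNorm {c : Associates GaussianInt}
    (hc : (associatesNorm c).Prime) : Prime c := by
  obtain ⟨z, rfl⟩ := Associates.mk_surjective c
  rw [associatesNorm_mk] at hc
  rw [Associates.prime_mk, ← irreducible_iff_prime]
  refine ⟨fun h ↦ hc.ne_one (Zsqrtd.norm_eq_one_iff.2 h), fun a b h ↦ ?_⟩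
  rw [h, Zsqrtd.norm_mul, Int.natAbs_mul] at hc
  rw [← Zsqrtd.norm_eq_one_iff, ← Zsqrtd.norm_eq_one_iff]
  exact (Nat.prime_mul_iff.1 hc).imp And.right And.right |>.symm

theorem associatesCount_two_pow (k : ℕ) : associatesCount (2 ^ k) = 1 := by
  rw [associatesCount_apply (by positivity), Nat.card_eq_one_iff_unique]
  set P : Associates GaussianInt := Associates.mk ⟨1, 1⟩
  have hN : associatesNorm P = 2 := by simp [P, Zsqrtd.norm_def]
  have hP : Prime P := prime_of_prime_associatesNorm (hN ▸ Nat.prime_two)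
  have h2 : Associates.mk ((2 : ℕ) : GaussianInt) = P ^ 2 := by
    rw [← Associates.mk_pow, Associates.mk_eq_mk_iff_associated]
    refine ⟨⟨⟨0, 1⟩, ⟨0, -1⟩, ?_, ?_⟩, ?_⟩ <;> simp [Zsqrtd.ext_iff, sq]
  have key (c : Associates GaussianInt) (hc : associatesNorm c = 2 ^ k) : c = P ^ k := by
    have hd := dvd_mk_natCast_pow hc
    rw [h2, ← pow_mul, dvd_prime_pow hP] at hd
    obtain ⟨j, -, hj⟩ := hd
    obtain rfl := associated_iff_eq.1 hj
    rw [map_pow, hN] at hc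
    rw [Nat.pow_right_injective le_rfl hc]
  exact ⟨⟨fun a b ↦ Subtype.ext ((key _ a.2).trans (key _ b.2).symm)⟩,
    ⟨⟨P ^ k, by rw [map_pow, hN]⟩⟩⟩

theorem associatesCount_prime_pow_of_mod_four_eq_three {p : ℕ} (hp : p.Prime) (h : p % 4 = 3)
    (k : ℕ) : associatesCount (p ^ k) = if Even k then 1 else 0 := by
  have := Fact.mk hp
  rw [associatesCount_apply (pow_ne_zero _ hp.ne_zero)]
  set P : Associates GaussianInt := Associates.mk p
  have hN : associatesNorm P = p ^ 2 := associatesNorm_mk_natCast p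
  have hP : Prime P := Associates.prime_mk.2 (prime_of_nat_prime_of_mod_four_eq_three p h)
  have key (c : Associates GaussianInt) (hc : associatesNorm c = p ^ k) :
      ∃ j, c = P ^ j ∧ 2 * j = k := by
    obtain ⟨j, -, hj⟩ := (dvd_prime_pow hP _).1 (dvd_mk_natCast_pow hc)
    obtain rfl := associated_iff_eq.1 hj
    rw [map_pow, hN, ← pow_mul] at hc
    exact ⟨j, rfl, Nat.pow_right_injective hp.two_le hc⟩
  split_ifs with hk
  · obtain ⟨j, rfl⟩ := hk.two_dvd
    rw [Nat.card_eq_one_iff_unique]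
    refine ⟨⟨fun a b ↦ Subtype.ext ?_⟩, ⟨⟨P ^ j, by rw [map_pow, hN, pow_mul]⟩⟩⟩
    obtain ⟨i, hi, hij⟩ := key _ a.2
    obtain ⟨i', hi', hij'⟩ := key _ b.2
    rw [hi, hi', show i = i' by lia]
  · have : IsEmpty {c : Associates GaussianInt // associatesNorm c = p ^ k} := by
      refine ⟨fun a ↦ hk ?_⟩
      obtain ⟨j, -, rfl⟩ := key _ a.2
      exact even_two_mul j
    exact Nat.card_of_isEmpty

theorem isRelPrime_mk_star {p : ℕ} (hp : p.Prime) (h : p % 4 = 1) {z : GaussianInt}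
    (hz : z.norm = p) : IsRelPrime (Associates.mk z) (Associates.mk (star z)) := by
  have hN : associatesNorm (Associates.mk z) = p := by simp [hz]
  have hP := prime_of_prime_associatesNorm (hN.symm ▸ hp)
  refine (hP.irreducible.dvd_or_isRelPrime (n := Associates.mk (star z))).resolve_left fun hd ↦ ?_
  rw [Associates.mk_dvd_mk] at hd
  have hp4 : ¬ (p : ℤ) ∣ 4 := fun h4 ↦ by
    have : p ∣ 2 ^ 2 := by exact_mod_cast h4
    have := (Nat.prime_dvd_prime_iff_eq hp Nat.prime_two).1 (hp.dvd_of_dvd_pow this)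
    lia
  have hpZ := Nat.prime_iff_prime_int.1 hp
  have norm_dvd {w : GaussianInt} (hw : z ∣ w) : (p : ℤ) ∣ w.norm :=
    hz ▸ map_dvd Zsqrtd.normMonoidHom hw
  have hre : (p : ℤ) ∣ z.re := by
    have : (p : ℤ) ∣ 4 * z.re ^ 2 := by
      convert norm_dvd (dvd_add (dvd_refl z) hd) using 1
      simp [Zsqrtd.norm_def]
      ring
    exact hpZ.dvd_of_dvd_pow ((hpZ.dvd_or_dvd this).resolve_left hp4)
  have him : (p : ℤ) ∣ z.im := by
    have : (p : ℤ) ∣ 4 * z.im ^ 2 := by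
      convert norm_dvd (dvd_sub (dvd_refl z) hd) using 1
      simp [Zsqrtd.norm_def]
      ring
    exact hpZ.dvd_of_dvd_pow ((hpZ.dvd_or_dvd this).resolve_left hp4)
  have : (p : ℤ) * p ∣ p * 1 := by
    rw [mul_one]
    nth_rw 3 [← hz]
    rw [Zsqrtd.norm_def]
    simpa using dvd_add (mul_dvd_mul hre hre) (mul_dvd_mul him him)
  exact hpZ.not_dvd_one (Int.dvd_of_mul_dvd_mul_left hpZ.ne_zero this)

theorem associatesCount_prime_pow_of_mod_four_eq_one {p : ℕ} (hp : p.Prime) (h : p % 4 = 1)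
    (k : ℕ) : associatesCount (p ^ k) = k + 1 := by
  have := Fact.mk hp
  obtain ⟨x, y, hxy⟩ := Nat.Prime.sq_add_sq (p := p) (by lia)
  obtain ⟨z, hz⟩ : ∃ z : GaussianInt, z.norm = p :=
    ⟨⟨x, y⟩, by simp [Zsqrtd.norm_def, ← hxy, sq]⟩
  have hPQ := isRelPrime_mk_star hp h hz
  have hpPQ : Associates.mk (p : GaussianInt) = Associates.mk z * Associates.mk (star z) := by
    rw [Associates.mk_mul_mk, ← Zsqrtd.norm_eq_mul_conj, hz, Int.cast_natCast]
  have hPN : associatesNorm (Associates.mk z) = p := by simp [hz]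
  have hQN : associatesNorm (Associates.mk (star z)) = p := by simp [hz]
  have hP := prime_of_prime_associatesNorm (hPN.symm ▸ hp)
  have hQ := prime_of_prime_associatesNorm (hQN.symm ▸ hp)
  generalize Associates.mk z = P at *
  generalize Associates.mk (star z) = Q at *
  rw [associatesCount_apply (pow_ne_zero _ hp.ne_zero), ← Finset.Nat.card_antidiagonal,
    ← Nat.card_eq_finsetCard]
  refine (Nat.card_congr (Equiv.ofBijective (fun x ↦ ⟨P ^ x.1.1 * Q ^ x.1.2, by
    rw [map_mul, map_pow, map_pow, hPN, hQN, ← pow_add,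
      Finset.HasAntidiagonal.mem_antidiagonal.1 x.2]⟩)
      ⟨?_, ?_⟩)).symm
  · have key (i j i' j' : ℕ) (h : P ^ i * Q ^ j = P ^ i' * Q ^ j') : i ≤ i' := by
      have hd : P ^ i ∣ P ^ i' :=
        (hPQ.pow (m := i) (n := j')).dvd_of_dvd_mul_right (h ▸ dvd_mul_right _ _)
      exact (pow_dvd_pow_iff hP.ne_zero hP.not_isUnit).1 hd
    rintro ⟨⟨i, j⟩, hij⟩ ⟨⟨i', j'⟩, hij'⟩ h
    have h : P ^ i * Q ^ j = P ^ i' * Q ^ j' := congrArg Subtype.val h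
    have := (key _ _ _ _ h).antisymm (key _ _ _ _ h.symm)
    rw [Finset.HasAntidiagonal.mem_antidiagonal] at hij hij'
    simp only [Subtype.mk.injEq, Prod.mk.injEq]
    lia
  · rintro ⟨c, hc⟩
    have hd := dvd_mk_natCast_pow hc
    rw [hpPQ, mul_pow] at hd
    obtain ⟨a, b, ha, hb, rfl⟩ := exists_dvd_and_dvd_of_dvd_mul hd
    obtain ⟨i, -, hi⟩ := (dvd_prime_pow hP _).1 ha
    obtain ⟨j, -, hj⟩ := (dvd_prime_pow hQ _).1 hb
    obtain rfl := associated_iff_eq.1 hi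
    obtain rfl := associated_iff_eq.1 hj
    rw [map_mul, map_pow, map_pow, hPN, hQN, ← pow_add] at hc
    exact ⟨⟨(i, j), Finset.HasAntidiagonal.mem_antidiagonal.2
      (Nat.pow_right_injective hp.two_le hc)⟩, rfl⟩

/-- The nontrivial quadratic character modulo `4` as a complex Dirichlet character. -/
noncomputable def chiFour : DirichletCharacter ℂ 4 := ZMod.χ₄.ringHomComp (Int.castRingHom ℂ)

theorem chiFour_natCast (n : ℕ) : chiFour n = ZMod.χ₄ n := rfl

theorem associatesCount_eq_zeta_mul :
    (associatesCount : ArithmeticFunction ℂ) =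
      (ArithmeticFunction.zeta : ArithmeticFunction ℂ) * toArithmeticFunction (chiFour ·) := by
  refine ((ArithmeticFunction.IsMultiplicative.eq_iff_eq_on_prime_powers _
    associatesCount_isMultiplicative.natCast _
    (ArithmeticFunction.isMultiplicative_zeta.natCast.mul
      (DirichletCharacter.isMultiplicative_toArithmeticFunction _))).2 fun p k hp ↦ ?_)
  have hsum : ((ArithmeticFunction.zeta : ArithmeticFunction ℂ) *
      toArithmeticFunction (chiFour ·)) (p ^ k) =
        ∑ j ∈ Finset.range (k + 1), ((ZMod.χ₄ p : ℤ) : ℂ) ^ j := by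
    rw [ArithmeticFunction.coe_zeta_mul_apply, Nat.sum_divisors_prime_pow hp]
    refine Finset.sum_congr rfl fun j _ ↦ ?_
    rw [← DirichletCharacter.apply_eq_toArithmeticFunction_apply _ (pow_ne_zero _ hp.ne_zero),
      Nat.cast_pow, map_pow, chiFour_natCast]
  rw [hsum, ArithmeticFunction.natCoe_apply]
  obtain rfl | hodd := hp.eq_two_or_odd
  · rw [associatesCount_two_pow, show ZMod.χ₄ ((2 : ℕ) : ZMod 4) = 0 from rfl,
      Finset.sum_range_succ']
    simp
  obtain h1 | h3 : p % 4 = 1 ∨ p % 4 = 3 := by lia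
  · rw [associatesCount_prime_pow_of_mod_four_eq_one hp h1, ZMod.χ₄_nat_one_mod_four h1]
    simp
  · rw [associatesCount_prime_pow_of_mod_four_eq_three hp h3, ZMod.χ₄_nat_three_mod_four h3]
    push_cast
    rw [neg_one_geom_sum]
    simp only [Nat.even_add_one]
    split_ifs <;> simp_all

/-- The nonzero Gaussian integers of norm at most `T`. -/
def normBall (T : ℕ) : Set GaussianInt := {z | z ≠ 0 ∧ z.norm ≤ (T : ℤ)}

/-- The coprime pairs of nonzero Gaussian integers of norm at most `T`. -/
def coprimePairs (T : ℕ) : Set (GaussianInt × GaussianInt) :=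
  {q | q.1 ∈ normBall T ∧ q.2 ∈ normBall T ∧ IsCoprime q.1 q.2}

theorem norm_le_natCast_iff {z : GaussianInt} {T : ℕ} : z.norm ≤ (T : ℤ) ↔ z.norm.natAbs ≤ T := by
  rw [← abs_natCast_norm, Nat.cast_le, Int.natAbs_natCast]

theorem finite_normBall (T : ℕ) : (normBall T).Finite :=
  (finite_norm_le T).subset fun _ hz ↦ norm_le_natCast_iff.1 hz.2

theorem normBall_zero : normBall 0 = ∅ := by
  refine Set.eq_empty_of_forall_notMem fun z hz ↦ hz.1 ?_
  exact GaussianInt.norm_eq_zero.1 (le_antisymm (by simpa using hz.2) (GaussianInt.norm_nonneg z))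

theorem mul_mem_normBall_iff {d z : GaussianInt} (hd : d ≠ 0) {T : ℕ} :
    d * z ∈ normBall T ↔ z ∈ normBall (T / d.norm.natAbs) := by
  have hd' : 0 < d.norm.natAbs := Int.natAbs_pos.2 (GaussianInt.norm_pos.2 hd).ne'
  simp only [normBall, Set.mem_ofPred_eq, norm_le_natCast_iff, mul_ne_zero_iff, hd, ne_eq,
    not_false_eq_true, true_and, Zsqrtd.norm_mul, Int.natAbs_mul, Nat.le_div_iff_mul_le hd',
    mul_comm]

open Classical in
theorem associated_gcd_iff {d : GaussianInt} (hd : d ≠ 0) (a b : GaussianInt) :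
    Associated (EuclideanDomain.gcd a b) d ↔
      ∃ z w, IsCoprime z w ∧ d * z = a ∧ d * w = b := by
  constructor
  · intro h
    obtain ⟨z, hz⟩ := h.symm.dvd.trans (EuclideanDomain.gcd_dvd_left a b)
    obtain ⟨w, hw⟩ := h.symm.dvd.trans (EuclideanDomain.gcd_dvd_right a b)
    obtain ⟨u, hu⟩ := h
    refine ⟨z, w, ⟨EuclideanDomain.gcdA a b * u, EuclideanDomain.gcdB a b * u, ?_⟩, hz.symm, hw.symm⟩
    have h1 := EuclideanDomain.gcd_eq_gcd_ab a b
    refine mul_left_cancel₀ hd ?_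
    linear_combination hu - (u : GaussianInt) * h1 - EuclideanDomain.gcdA a b * u * hz -
      EuclideanDomain.gcdB a b * u * hw
  · rintro ⟨z, w, ⟨u, v, huv⟩, rfl, rfl⟩
    refine associated_of_dvd_dvd ?_
      (EuclideanDomain.dvd_gcd (dvd_mul_right d z) (dvd_mul_right d w))
    have : d = (d * z) * u + (d * w) * v := by linear_combination -d * huv
    rw [this]
    refine dvd_add ?_ ?_
    · rw [← this]; exact (EuclideanDomain.gcd_dvd_left _ _).mul_right _
    · rw [← this]; exact (EuclideanDomain.gcd_dvd_right _ _).mul_right _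

theorem ncard_normBall_sq (T : ℕ) :
    (normBall T).ncard ^ 2 =
      ∑ n ∈ Finset.Ioc 0 T, associatesCount n * (coprimePairs (T / n)).ncard := by
  classical
  set B := (finite_normBall T).toFinset
  set C := ((finite_associatesNorm_le T).subset (Set.sep_subset _ (· ≠ 0))).toFinset with hC
  have mem_C {c : Associates GaussianInt} : c ∈ C ↔ associatesNorm c ≤ T ∧ c ≠ 0 := by simp [hC]
  have mem_B {z : GaussianInt} : z ∈ B ↔ z ∈ normBall T := by simp [B]
  have hmaps : Set.MapsTo
      (fun q : GaussianInt × GaussianInt ↦ Associates.mk (EuclideanDomain.gcd q.1 q.2))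
      (↑(B ×ˢ B : Finset (GaussianInt × GaussianInt)) : Set (GaussianInt × GaussianInt))
      (C : Set (Associates GaussianInt)) := by
    rintro ⟨a, b⟩ hq
    rw [Finset.mem_coe, Finset.mem_product, mem_B, mem_B] at hq
    have ha : 0 < a.norm.natAbs := Int.natAbs_pos.2 (GaussianInt.norm_pos.2 hq.1.1).ne'
    rw [Finset.mem_coe, mem_C, associatesNorm_mk, Ne, Associates.mk_eq_zero,
      EuclideanDomain.gcd_eq_zero_iff]
    refine ⟨(Nat.le_of_dvd ha ?_).trans (norm_le_natCast_iff.1 hq.1.2), fun h ↦ hq.1.1 h.1⟩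
    exact Int.natAbs_dvd_natAbs.2
      (map_dvd Zsqrtd.normMonoidHom (EuclideanDomain.gcd_dvd_left a b))
  have hfiber (c) (hc : c ∈ C) :
      {q ∈ B ×ˢ B | Associates.mk (EuclideanDomain.gcd q.1 q.2) = c}.card =
        (coprimePairs (T / associatesNorm c)).ncard := by
    obtain ⟨d, rfl⟩ := Associates.mk_surjective c
    have hd : d ≠ 0 := by simpa using (mem_C.1 hc).2
    have hinj : Function.Injective (Prod.map (d * ·) (d * ·)) :=
      (mul_right_injective₀ hd).prodMap (mul_right_injective₀ hd)
    rw [← Set.ncard_coe_finset, ← Set.ncard_image_of_injective (coprimePairs _) hinj]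
    congr 1
    ext ⟨a, b⟩
    simp only [Finset.coe_filter, Finset.mem_product, mem_B, Set.mem_ofPred_eq,
      Associates.mk_eq_mk_iff_associated, associated_gcd_iff hd, coprimePairs, associatesNorm_mk,
      Set.mem_image, Prod.exists, Prod.map_apply, Prod.mk.injEq, ← mul_mem_normBall_iff hd]
    constructor
    · rintro ⟨⟨ha, hb⟩, z, w, h, rfl, rfl⟩
      exact ⟨z, w, ⟨ha, hb, h⟩, rfl, rfl⟩
    · rintro ⟨z, w, ⟨ha, hb, h⟩, rfl, rfl⟩
      exact ⟨⟨ha, hb⟩, z, w, h, rfl, rfl⟩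
  have hmaps' : Set.MapsTo associatesNorm (C : Set (Associates GaussianInt)) (Finset.Ioc 0 T) := by
    intro c hc
    rw [Finset.mem_coe, mem_C] at hc
    simpa [Nat.pos_iff_ne_zero, associatesNorm_eq_zero_iff] using hc.symm
  calc (normBall T).ncard ^ 2 = (B ×ˢ B).card := by
        rw [Finset.card_product, sq, Set.ncard_eq_toFinset_card _ (finite_normBall T)]
    _ = ∑ c ∈ C, (coprimePairs (T / associatesNorm c)).ncard := by
        rw [Finset.card_eq_sum_card_fiberwise hmaps]
        exact Finset.sum_congr rfl hfiber
    _ = ∑ n ∈ Finset.Ioc 0 T, ∑ c ∈ C with associatesNorm c = n,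
          (coprimePairs (T / associatesNorm c)).ncard :=
        (Finset.sum_fiberwise_of_maps_to hmaps' _).symm
    _ = _ := by
        refine Finset.sum_congr rfl fun n hn ↦ ?_
        rw [Finset.mem_Ioc] at hn
        rw [Finset.sum_congr rfl (g := fun _ ↦ (coprimePairs (T / n)).ncard) fun c hc ↦ by
          rw [(Finset.mem_filter.1 hc).2], Finset.sum_const, smul_eq_mul,
          associatesCount_apply hn.1.ne', ← Nat.subtype_card]
        intro c
        rw [Finset.mem_filter, mem_C, and_iff_right_iff_imp]
        rintro rfl
        exact ⟨hn.2, fun h ↦ hn.1.ne' (associatesNorm_eq_zero_iff.2 h)⟩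

/-- The Gaussian integers of norm at most `T` are asymptotically proportional to `T`. -/
theorem exists_tendsto_ncard_normBall_div :
    ∃ κ : ℝ, 0 < κ ∧ Tendsto (fun T : ℕ ↦ ((normBall T).ncard : ℝ) / T) atTop (𝓝 κ) := by
  let L : Submodule ℤ (Fin 2 → ℝ) := Submodule.span ℤ (Set.range (Pi.basisFun ℝ (Fin 2)))
  let F : (Fin 2 → ℝ) → ℝ := fun v ↦ v 0 ^ 2 + v 1 ^ 2
  have hF : Continuous F := by fun_prop
  let D : Set (Fin 2 → ℝ) := {v ∈ Set.univ | F v ≤ 1}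
  have hD : D = {v | F v ≤ 1} := by simp [D]
  have hclosed : IsClosed D := hD ▸ isClosed_le hF continuous_const
  have hbdd : Bornology.IsBounded D := by
    refine (Metric.isBounded_closedBall (x := (0 : Fin 2 → ℝ)) (r := 1)).subset fun v hv ↦ ?_
    have hv : v 0 ^ 2 + v 1 ^ 2 ≤ 1 := hv.2
    rw [mem_closedBall_zero_iff, pi_norm_le_iff_of_nonneg zero_le_one, Fin.forall_fin_two]
    simp only [Real.norm_eq_abs]
    constructor <;> refine abs_le_one_iff_mul_self_le_one.2 ?_ <;>
      nlinarith [sq_nonneg (v 0), sq_nonneg (v 1)]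
  have hconv : Convex ℝ D := by
    rw [hD]
    have h (i : Fin 2) : ConvexOn ℝ Set.univ fun v : Fin 2 → ℝ ↦ v i ^ 2 :=
      (even_two.convexOn_pow (𝕜 := ℝ)).comp_linearMap
        (LinearMap.proj (R := ℝ) (φ := fun _ : Fin 2 ↦ ℝ) i)
    simpa using ((h 0).add (h 1)).convex_le 1
  have hlim := ZLattice.covolume.tendsto_card_le_div L (X := Set.univ) (F := F)
    (fun _ _ _ _ ↦ trivial)
    (fun x r _ ↦ by simp only [F, Pi.smul_apply, smul_eq_mul, Fintype.card_fin]; ring)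
    hbdd hclosed.measurableSet (hconv.addHaar_frontier _)
  have hpos : 0 < MeasureTheory.volume.real D := by
    refine ENNReal.toReal_pos (ne_of_gt ?_) hbdd.measure_lt_top.ne
    refine lt_of_lt_of_le (IsOpen.measure_pos _ (isOpen_lt hF continuous_const)
      ⟨(0 : Fin 2 → ℝ), ?_⟩) (MeasureTheory.measure_mono (?_ : {v | F v < 1} ⊆ D))
    · simp [F]
    · exact fun v hv ↦ ⟨trivial, le_of_lt hv⟩
  refine ⟨_, div_pos hpos (ZLattice.covolume_pos L MeasureTheory.volume), ?_⟩
  have hcard (T : ℕ) : Nat.card ({v ∈ Set.univ | F v ≤ (T : ℝ)} ∩ L : Set (Fin 2 → ℝ)) =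
      (normBall T).ncard + 1 := by
    have h0 : (0 : GaussianInt) ∉ normBall T := fun h ↦ h.1 rfl
    rw [← Set.ncard_insert_of_notMem h0 (finite_normBall T), Nat.card_coe_set_eq]
    have hinj : Function.Injective fun z : GaussianInt ↦ (![(z.re : ℝ), z.im] : Fin 2 → ℝ) := by
      intro z w h
      exact Zsqrtd.ext (Int.cast_injective (congrFun h 0)) (Int.cast_injective (congrFun h 1))
    rw [← Set.ncard_image_of_injective _ hinj]
    congr 1
    have hnorm (z : GaussianInt) : F ![(z.re : ℝ), z.im] ≤ T ↔ z.norm ≤ (T : ℤ) := by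
      rw [← Int.cast_le (R := ℝ), Zsqrtd.norm_def]
      simp [F, sq]
    ext v
    constructor
    · rintro ⟨⟨-, hv⟩, hvL⟩
      rw [SetLike.mem_coe, Module.Basis.mem_span_iff_repr_mem] at hvL
      obtain ⟨a, ha⟩ := hvL 0
      obtain ⟨b, hb⟩ := hvL 1
      obtain rfl : v = ![(a : ℝ), b] := by
        ext i
        fin_cases i
        · simpa using ha.symm
        · simpa using hb.symm
      refine ⟨⟨a, b⟩, ?_, rfl⟩
      rw [Set.mem_insert_iff, or_iff_not_imp_left]
      exact fun h ↦ ⟨h, (hnorm ⟨a, b⟩).1 hv⟩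
    · rintro ⟨z, hz, rfl⟩
      refine ⟨⟨trivial, (hnorm z).2 ?_⟩, ?_⟩
      · obtain rfl | hz := hz
        · simp
        · exact hz.2
      · rw [SetLike.mem_coe, Module.Basis.mem_span_iff_repr_mem, Fin.forall_fin_two]
        exact ⟨⟨z.re, by simp [-intCast_re]⟩, ⟨z.im, by simp [-intCast_im]⟩⟩
  have := (hlim.comp tendsto_natCast_atTop_atTop).sub (tendsto_one_div_atTop_nhds_zero_nat (𝕜 := ℝ))
  rw [sub_zero] at this
  refine this.congr fun T ↦ ?_
  simp only [Function.comp_apply, hcard]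
  push_cast
  ring

/-- The Dirichlet inverse of `associatesCount`. -/
noncomputable def associatesMoebius : ArithmeticFunction ℂ :=
  (ArithmeticFunction.moebius : ArithmeticFunction ℂ) *
    toArithmeticFunction fun n ↦ chiFour n * (ArithmeticFunction.moebius n : ℂ)

theorem associatesMoebius_mul_associatesCount :
    associatesMoebius * (associatesCount : ArithmeticFunction ℂ) = 1 := by
  have h : toArithmeticFunction (chiFour ·) *
      toArithmeticFunction (fun n ↦ chiFour n * (ArithmeticFunction.moebius n : ℂ)) = 1 := by
    exact DFunLike.coe_injective ((DirichletCharacter.convolution_mul_moebius chiFour).trans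
      ArithmeticFunction.one_eq_delta.symm)
  rw [associatesCount_eq_zeta_mul, associatesMoebius, mul_mul_mul_comm,
    ArithmeticFunction.coe_moebius_mul_coe_zeta, one_mul, mul_comm, h]

theorem lseriesSummable_toArithmeticFunction {f : ℕ → ℂ} {s : ℂ} (hf : LSeriesSummable f s) :
    LSeriesSummable (fun n ↦ toArithmeticFunction f n) s :=
  (LSeriesSummable_congr s fun hn ↦ by simp [toArithmeticFunction, hn]).2 hf

theorem lseries_toArithmeticFunction (f : ℕ → ℂ) (s : ℂ) :
    LSeries (fun n ↦ toArithmeticFunction f n) s = LSeries f s :=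
  LSeries_congr (fun hn ↦ by simp [toArithmeticFunction, hn]) s

theorem lseriesSummable_associatesMoebius : LSeriesSummable (associatesMoebius ·) 2 := by
  refine ArithmeticFunction.LSeriesSummable_mul ?_ (lseriesSummable_toArithmeticFunction ?_)
  · exact ArithmeticFunction.LSeriesSummable_moebius_iff.2 (by simp)
  · exact DirichletCharacter.LSeriesSummable_mul chiFour
      (ArithmeticFunction.LSeriesSummable_moebius_iff.2 (by simp))

theorem lseries_chiFour_two :
    LSeries (chiFour ·) 2 = ((∑' k : ℕ, (-1) ^ k / (2 * (k : ℝ) + 1) ^ 2 : ℝ) : ℂ) := by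
  have hs : Summable fun n ↦ LSeries.term (chiFour ·) 2 n :=
    DirichletCharacter.LSeriesSummable_of_one_lt_re chiFour (by simp)
  have heven (k : ℕ) : LSeries.term (chiFour ·) 2 (2 * k) = 0 := by
    refine (LSeries.term_def₀ ?_ 2 _).trans ?_
    · simp [chiFour]
    · rw [chiFour_natCast, ZMod.χ₄_nat_eq_if_mod_four, if_pos (by lia), Int.cast_zero, zero_mul]
  have hodd (k : ℕ) : LSeries.term (chiFour ·) 2 (2 * k + 1) =
      (((-1) ^ k / (2 * (k : ℝ) + 1) ^ 2 : ℝ) : ℂ) := by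
    rw [LSeries.term_of_ne_zero (Nat.succ_ne_zero _), chiFour_natCast,
      ZMod.χ₄_eq_neg_one_pow (by lia), show (2 * k + 1) / 2 = k by lia]
    push_cast
    norm_cast
  rw [LSeries, ← tsum_even_add_odd (hs.comp_injective (mul_right_injective₀ two_ne_zero))
    (hs.comp_injective ((add_left_injective 1).comp (mul_right_injective₀ two_ne_zero))),
    Complex.ofReal_tsum]
  simp only [heven, hodd, tsum_zero, zero_add]

theorem lseries_associatesMoebius :
    LSeries (associatesMoebius ·) 2 =
      ((1 / ((π ^ 2 / 6) * ∑' k : ℕ, (-1) ^ k / (2 * (k : ℝ) + 1) ^ 2) : ℝ) : ℂ) := by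
  have h2 : 1 < (2 : ℂ).re := by simp
  have hμ := ArithmeticFunction.LSeriesSummable_moebius_iff.2 h2
  have hz := ArithmeticFunction.LSeries_zeta_mul_Lseries_moebius h2
  have hχ := DirichletCharacter.LSeries.mul_mu_eq_one chiFour h2
  rw [ArithmeticFunction.LSeries_zeta_eq_riemannZeta h2, riemannZeta_two] at hz
  rw [lseries_chiFour_two] at hχ
  have h : LSeries (associatesMoebius ·) 2 = LSeries (ArithmeticFunction.moebius ·) 2 *
      LSeries (fun n : ℕ ↦ chiFour n * (ArithmeticFunction.moebius n : ℂ)) 2 := by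
    rw [← lseries_toArithmeticFunction fun n ↦ chiFour n * (ArithmeticFunction.moebius n : ℂ)]
    exact ArithmeticFunction.LSeries_mul' hμ (lseriesSummable_toArithmeticFunction
      (DirichletCharacter.LSeriesSummable_mul chiFour hμ))
  rw [h, Complex.ofReal_div, Complex.ofReal_mul, Complex.ofReal_one]
  refine eq_one_div_of_mul_eq_one_right ?_
  rw [mul_mul_mul_comm]
  refine (congrArg _ hχ).trans ?_
  rw [mul_one]
  push_cast
  exact hz

theorem ncard_coprimePairs_eq_sum (T : ℕ) :
    ((coprimePairs T).ncard : ℂ) =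
      ∑ n ∈ Finset.Ioc 0 T, associatesMoebius n * ((normBall (T / n)).ncard : ℂ) ^ 2 := by
  have h := ArithmeticFunction.sum_Ioc_mul_apply_div associatesMoebius
    (associatesCount : ArithmeticFunction ℂ) (fun t ↦ ((coprimePairs t).ncard : ℂ)) T
  simp only [associatesMoebius_mul_associatesCount, ArithmeticFunction.natCoe_apply] at h
  obtain rfl | hT := T.eq_zero_or_pos
  · simp [coprimePairs, normBall_zero]
  rw [Finset.sum_eq_single_of_mem 1 (by simpa [Nat.one_le_iff_ne_zero] using hT.ne')
    fun n _ hn ↦ by rw [ArithmeticFunction.one_apply_ne hn, zero_mul],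
    ArithmeticFunction.one_one, one_mul, Nat.div_one] at h
  rw [h]
  refine Finset.sum_congr rfl fun n _ ↦ ?_
  exact_mod_cast congrArg (associatesMoebius n * Nat.cast ·) (ncard_normBall_sq (T / n)).symm

theorem ncard_coprimePairs_div_sq_eq_tsum (T : ℕ) :
    ((coprimePairs T).ncard : ℂ) / T ^ 2 =
      ∑' n, associatesMoebius n * (((normBall (T / n)).ncard / T : ℝ) : ℂ) ^ 2 := by
  rw [ncard_coprimePairs_eq_sum, Finset.sum_div, tsum_eq_sum (s := Finset.Ioc 0 T)]
  · refine Finset.sum_congr rfl fun n _ ↦ ?_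
    push_cast
    rw [div_pow, mul_div_assoc]
  · intro n hn
    obtain rfl | hn0 := n.eq_zero_or_pos
    · simp
    · have : T / n = 0 := Nat.div_eq_of_lt (by simpa [hn0] using hn)
      simp [this, normBall_zero]

theorem exists_ncard_normBall_div_div_le :
    ∃ M : ℝ, ∀ T n : ℕ, ((normBall (T / n)).ncard : ℝ) / T ≤ M / n := by
  obtain ⟨κ, -, h⟩ := exists_tendsto_ncard_normBall_div
  obtain ⟨M, hM⟩ := h.bddAbove_range
  have hM0 : 0 ≤ M := (div_nonneg (Nat.cast_nonneg _) (Nat.cast_nonneg _)).trans (hM ⟨0, rfl⟩)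
  refine ⟨M, fun T n ↦ ?_⟩
  obtain hTn | hTn := (T / n).eq_zero_or_pos
  · rw [hTn, normBall_zero, Set.ncard_empty, Nat.cast_zero, zero_div]
    positivity
  have hT : 0 < (T : ℝ) := Nat.cast_pos.2 (hTn.trans_le (Nat.div_le_self T n))
  calc ((normBall (T / n)).ncard : ℝ) / T
      ≤ M * (T / n : ℕ) / T := by
        gcongr
        exact (div_le_iff₀ (Nat.cast_pos.2 hTn)).1 (hM ⟨T / n, rfl⟩)
    _ ≤ M * (T / n) / T := by
        gcongr
        exact Nat.cast_div_le
    _ = M / n := by field_simp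

theorem tendsto_ncard_normBall_div_div {κ : ℝ}
    (h : Tendsto (fun T : ℕ ↦ ((normBall T).ncard : ℝ) / T) atTop (𝓝 κ)) {n : ℕ} (hn : 0 < n) :
    Tendsto (fun T : ℕ ↦ ((normBall (T / n)).ncard : ℝ) / T) atTop (𝓝 (κ / n)) := by
  have hdiv := (h.comp (Nat.tendsto_div_const_atTop hn.ne')).mul
    ((tendsto_nat_floor_div_atTop (R := ℝ)).comp
      (tendsto_natCast_atTop_atTop.atTop_div_const (Nat.cast_pos.2 hn)))
  have := (hdiv.div_const (n : ℝ))
  rw [mul_one] at this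
  refine this.congr' ?_
  filter_upwards [eventually_ge_atTop n] with T hT
  have h1 : ((T / n : ℕ) : ℝ) ≠ 0 := Nat.cast_ne_zero.2 (Nat.div_pos hT hn).ne'
  have h2 : (T : ℝ) ≠ 0 := Nat.cast_ne_zero.2 (hn.trans_le hT).ne'
  have h3 : (n : ℝ) ≠ 0 := Nat.cast_ne_zero.2 hn.ne'
  simp only [Function.comp_apply, Nat.floor_div_eq_div]
  field_simp

theorem tendsto_ncard_coprimePairs_div_sq {κ : ℝ}
    (h : Tendsto (fun T : ℕ ↦ ((normBall T).ncard : ℝ) / T) atTop (𝓝 κ)) :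
    Tendsto (fun T : ℕ ↦ ((coprimePairs T).ncard : ℂ) / T ^ 2) atTop
      (𝓝 (κ ^ 2 * LSeries (associatesMoebius ·) 2)) := by
  obtain ⟨M, hM⟩ := exists_ncard_normBall_div_div_le
  have hterm (n : ℕ) :
      LSeries.term (associatesMoebius ·) 2 n = associatesMoebius n / (n : ℂ) ^ 2 := by
    rw [LSeries.term_def₀ (by simp), Complex.cpow_neg, ← div_eq_mul_inv]
    norm_cast
  simp_rw [ncard_coprimePairs_div_sq_eq_tsum]
  rw [LSeries, ← tsum_mul_left]
  refine tendsto_tsum_of_dominated_convergence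
    (lseriesSummable_associatesMoebius.norm.mul_left (M ^ 2)) (fun n ↦ ?_) (.of_forall fun T n ↦ ?_)
  · obtain rfl | hn := n.eq_zero_or_pos
    · simp
    · rw [show κ ^ 2 * LSeries.term (associatesMoebius ·) 2 n =
          associatesMoebius n * ((κ / n : ℝ) : ℂ) ^ 2 by rw [hterm]; push_cast; ring]
      exact (((Complex.continuous_ofReal.tendsto _).comp
        (tendsto_ncard_normBall_div_div h hn)).pow 2).const_mul (associatesMoebius n)
  · rw [hterm, norm_mul, norm_div, norm_pow, norm_pow, Complex.norm_real, Complex.norm_natCast,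
      mul_div_left_comm, ← div_pow, Real.norm_of_nonneg (by positivity)]
    exact mul_le_mul_of_nonneg_left (pow_le_pow_left₀ (by positivity) (hM T n) 2)
      (_root_.norm_nonneg _)

theorem tendsto_ncard_coprimePairs_div_ncard_normBall_sq :
    Tendsto (fun T : ℕ ↦ ((coprimePairs T).ncard : ℝ) / ((normBall T).ncard : ℝ) ^ 2) atTop
      (𝓝 (1 / ((π ^ 2 / 6) * ∑' k : ℕ, (-1) ^ k / (2 * (k : ℝ) + 1) ^ 2))) := by
  obtain ⟨κ, hκ, h⟩ := exists_tendsto_ncard_normBall_div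
  have hP := tendsto_ncard_coprimePairs_div_sq h
  rw [lseries_associatesMoebius] at hP
  have hP' : Tendsto (fun T : ℕ ↦ ((coprimePairs T).ncard : ℝ) / (T : ℝ) ^ 2) atTop
      (𝓝 (κ ^ 2 * (1 / ((π ^ 2 / 6) * ∑' k : ℕ, (-1) ^ k / (2 * (k : ℝ) + 1) ^ 2)))) := by
    rw [← Filter.tendsto_ofReal_iff, Complex.ofReal_mul, Complex.ofReal_pow]
    exact hP.congr fun T ↦ by push_cast; rfl
  have hlim := hP'.div (h.pow 2) (pow_ne_zero 2 hκ.ne')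
  rw [mul_div_cancel_left₀ _ (pow_ne_zero 2 hκ.ne')] at hlim
  refine hlim.congr' ?_
  filter_upwards [eventually_gt_atTop 0] with T hT
  rw [Pi.div_apply, div_pow, div_div_div_cancel_right₀ (pow_ne_zero 2 (Nat.cast_ne_zero.2 hT.ne'))]

end GaussianInt

/-- The asymptotic density of coprime pairs of Gaussian integers equals `1 / (ζ(2) β(2))`,
where `ζ(2) = π² / 6` and `β(2) = ∑_{k ≥ 0} (-1)ᵏ / (2k+1)²` is Catalan's constant:
with `Bₙ = {z ∈ ℤ[i] : z ≠ 0, N(z) ≤ n²}`, the proportion of pairs `(z, w) ∈ Bₙ × Bₙ`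
with `z` and `w` coprime in `ℤ[i]` tends to `1 / (ζ(2) β(2))`. -/
theorem gaussianInt_coprime_density :
    Tendsto (fun n : ℕ =>
        (({q : GaussianInt × GaussianInt |
            (q.1 ≠ 0 ∧ q.1.norm ≤ (n : ℤ) ^ 2) ∧ (q.2 ≠ 0 ∧ q.2.norm ≤ (n : ℤ) ^ 2) ∧
              IsCoprime q.1 q.2}.ncard : ℝ) /
          ({z : GaussianInt | z ≠ 0 ∧ z.norm ≤ (n : ℤ) ^ 2}.ncard : ℝ) ^ 2))
      atTop
      (𝓝 (1 / ((π ^ 2 / 6) * ∑' k : ℕ, (-1) ^ k / (2 * (k : ℝ) + 1) ^ 2))) := by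
  refine (GaussianInt.tendsto_ncard_coprimePairs_div_ncard_normBall_sq.comp
    (tendsto_pow_atTop two_ne_zero)).congr fun n ↦ ?_
  simp only [Function.comp_apply, GaussianInt.coprimePairs, GaussianInt.normBall, Nat.cast_pow,
    Set.mem_ofPred_eq]
end
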